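/- arXiv:1712.06692 — 2 statements merged into one kernel-verified Lean document; each statement's English description precedes it below -/
import Mathlib

section
/- The cyclic subgroup commutativity degree of ZM(9,4,8) equals 17/25. -/
open Pointwise

/-- The relators of the Zassenhaus metacyclic group
`ZM(m,n,r) = ⟨a, b | a^m = b^n = 1, b⁻¹ab = a^r⟩`. -/
def ZMrel (m n r : ℕ) : Set (FreeGroup (Fin 2)) :=
  {FreeGroup.of 0 ^ m, FreeGroup.of 1 ^ n,
   (FreeGroup.of 1)⁻¹ * FreeGroup.of 0 * FreeGroup.of 1 * (FreeGroup.of 0 ^ r)⁻¹}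

/-- The ZM-group `ZM(m,n,r)` as a presented group. -/
abbrev ZM (m n r : ℕ) : Type := PresentedGroup (ZMrel m n r)

/-- The generator `a` of `ZM(m,n,r)`. -/
def za (m n r : ℕ) : ZM m n r := PresentedGroup.of 0

/-- The generator `b` of `ZM(m,n,r)`. -/
def zb (m n r : ℕ) : ZM m n r := PresentedGroup.of 1

/-- The homomorphism out of a generalised quaternion group determined by the images `c` and `x` of
`a 1` and `xa 0`. -/
def QuaternionGroup.lift {G : Type*} [Group G] {n : ℕ} (c x : G) (hc : c ^ (2 * n) = 1)
    (hx : x ^ 2 = c ^ n) (hcx : c * x = x * c⁻¹) : QuaternionGroup n →* G :=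
  let F : ZMod (2 * n) →+ Additive G :=
    ZMod.lift (2 * n) ⟨zmultiplesHom (Additive G) (Additive.ofMul c), by
      rw [zmultiplesHom_apply, natCast_zsmul, ← ofMul_pow, hc, ofMul_one]⟩
  have hF (k : ℤ) : (F k).toMul = c ^ k := by simp [F]
  have hFx (i : ZMod (2 * n)) : (F i).toMul * x = x * (F (-i)).toMul := by
    obtain ⟨k, rfl⟩ := ZMod.intCast_surjective i
    have h : SemiconjBy x c⁻¹ c := hcx.symm
    rw [← Int.cast_neg, hF, hF, zpow_neg, ← inv_zpow]
    exact (h.zpow_right k).symm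
  have hFn : (F (n : ZMod (2 * n))).toMul = x * x := by
    rw [← sq, hx, ← Int.cast_natCast, hF, zpow_natCast]
  MonoidHom.mk'
    (fun
      | .a i => (F i).toMul
      | .xa i => x * (F i).toMul)
    (by
      rintro (i | i) (j | j)
      · simp
      · simp only [QuaternionGroup.a_mul_xa]
        rw [← mul_assoc, hFx, mul_assoc, ← toMul_add, ← map_add, neg_add_eq_sub]
      · simp [mul_assoc]
      · simp only [QuaternionGroup.xa_mul_xa]
        rw [mul_assoc, ← mul_assoc (F i).toMul, hFx, add_sub_assoc, map_add, toMul_add, hFn,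
          mul_assoc, mul_assoc, ← toMul_add, ← map_add, neg_add_eq_sub])

theorem QuaternionGroup.lift_a_intCast {G : Type*} [Group G] {n : ℕ} (c x : G)
    (hc : c ^ (2 * n) = 1) (hx : x ^ 2 = c ^ n) (hcx : c * x = x * c⁻¹) (k : ℤ) :
    QuaternionGroup.lift c x hc hx hcx (.a k) = c ^ k := by
  simp [QuaternionGroup.lift]

theorem QuaternionGroup.lift_xa_intCast {G : Type*} [Group G] {n : ℕ} (c x : G)
    (hc : c ^ (2 * n) = 1) (hx : x ^ 2 = c ^ n) (hcx : c * x = x * c⁻¹) (k : ℤ) :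
    QuaternionGroup.lift c x hc hx hcx (.xa k) = x * c ^ k := by
  simp [QuaternionGroup.lift]

theorem za_pow_nine : za 9 4 8 ^ 9 = 1 :=
  PresentedGroup.one_of_mem (rels := ZMrel 9 4 8) (Or.inl rfl)

theorem zb_pow_four : zb 9 4 8 ^ 4 = 1 :=
  PresentedGroup.one_of_mem (rels := ZMrel 9 4 8) (Or.inr (Or.inl rfl))

theorem semiconjBy_zb_za : SemiconjBy (zb 9 4 8) (za 9 4 8)⁻¹ (za 9 4 8) := by
  have h : (zb 9 4 8)⁻¹ * za 9 4 8 * zb 9 4 8 * (za 9 4 8 ^ 8)⁻¹ = 1 :=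
    PresentedGroup.one_of_mem (rels := ZMrel 9 4 8) (Or.inr (Or.inr rfl))
  have h8 : za 9 4 8 ^ 8 = (za 9 4 8)⁻¹ := by
    rw [eq_inv_iff_mul_eq_one, ← pow_succ, za_pow_nine]
  rw [mul_inv_eq_one, h8, mul_assoc, inv_mul_eq_iff_eq_mul] at h
  exact h.symm

theorem commute_za_zb_sq : Commute (za 9 4 8) (zb 9 4 8 ^ 2) := by
  have h := semiconjBy_zb_za.mul_left semiconjBy_zb_za.inv_right
  rw [inv_inv, ← sq] at h
  exact Commute.symm h

/-- `ZM(9,4,8)` is the dicyclic group of order `36`. -/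
def zmEquivQuaternionGroup : ZM 9 4 8 ≃* QuaternionGroup 9 :=
  have hpow (k : ℕ) : (za 9 4 8 ^ 5 * zb 9 4 8 ^ 2) ^ k =
      za 9 4 8 ^ (5 * k) * zb 9 4 8 ^ (2 * k) := by
    rw [(commute_za_zb_sq.pow_left 5).mul_pow, ← pow_mul, ← pow_mul]
  have ha (k : ℕ) : za 9 4 8 ^ (9 * k) = 1 := by rw [pow_mul, za_pow_nine, one_pow]
  have hb (k : ℕ) : zb 9 4 8 ^ (4 * k) = 1 := by rw [pow_mul, zb_pow_four, one_pow]
  let f : ZM 9 4 8 →* QuaternionGroup 9 :=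
    PresentedGroup.toGroup (rels := ZMrel 9 4 8) (f := ![.a 2, .xa 0]) (by
      rintro r (rfl | rfl | rfl)
      · simp only [map_pow, FreeGroup.lift_apply_of]; decide +kernel
      · simp only [map_pow, FreeGroup.lift_apply_of]; decide +kernel
      · simp only [map_mul, map_inv, map_pow, FreeGroup.lift_apply_of]; decide +kernel)
  have hfa : f (za 9 4 8) = .a 2 := PresentedGroup.toGroup.of _
  have hfb : f (zb 9 4 8) = .xa 0 := PresentedGroup.toGroup.of _
  have hc : (za 9 4 8 ^ 5 * zb 9 4 8 ^ 2) ^ (2 * 9) = 1 := by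
    rw [hpow, ha 10, hb 9, one_mul]
  have hx : zb 9 4 8 ^ 2 = (za 9 4 8 ^ 5 * zb 9 4 8 ^ 2) ^ 9 := by
    rw [hpow, ha 5, one_mul, pow_add _ 2 16, hb 4, mul_one]
  have hcx : za 9 4 8 ^ 5 * zb 9 4 8 ^ 2 * zb 9 4 8 =
      zb 9 4 8 * (za 9 4 8 ^ 5 * zb 9 4 8 ^ 2)⁻¹ := by
    have h2 : (zb 9 4 8 ^ 2)⁻¹ = zb 9 4 8 ^ 2 := by
      rw [inv_eq_iff_mul_eq_one, ← pow_add, zb_pow_four]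
    have h5 := (semiconjBy_zb_za.pow_right 5).eq
    rw [(commute_za_zb_sq.pow_left 5).mul_inv, h2, ← inv_pow, ← mul_assoc, h5, mul_assoc,
      mul_assoc, ← pow_succ, ← pow_succ']
  let g := QuaternionGroup.lift _ _ hc hx hcx
  MonoidHom.toMulEquiv f g
    (by
      refine PresentedGroup.ext fun i => ?_
      fin_cases i
      · change g (f (za 9 4 8)) = za 9 4 8
        rw [hfa]
        refine (QuaternionGroup.lift_a_intCast _ _ hc hx hcx 2).trans ?_
        rw [zpow_ofNat, hpow, hb 1, mul_one, pow_succ, ha 1, one_mul]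
      · change g (f (zb 9 4 8)) = zb 9 4 8
        rw [hfb]
        refine (QuaternionGroup.lift_xa_intCast _ _ hc hx hcx 0).trans ?_
        rw [zpow_zero, mul_one])
    (by
      have hfc : f (za 9 4 8 ^ 5 * zb 9 4 8 ^ 2) = .a 1 := by
        rw [map_mul, map_pow, map_pow, hfa, hfb]
        decide +kernel
      ext q
      obtain i | i := q <;> obtain ⟨k, rfl⟩ := ZMod.natCast_zmod_surjective i
      · have h := QuaternionGroup.lift_a_intCast _ _ hc hx hcx k
        rw [Int.cast_natCast, zpow_natCast] at h
        rw [MonoidHom.comp_apply, h, map_pow, hfc, QuaternionGroup.a_one_pow]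
        rfl
      · have h := QuaternionGroup.lift_xa_intCast _ _ hc hx hcx k
        rw [Int.cast_natCast, zpow_natCast] at h
        rw [MonoidHom.comp_apply, h, map_mul, map_pow, hfc, hfb, QuaternionGroup.a_one_pow,
          QuaternionGroup.xa_mul_a, zero_add]
        rfl)

/-- The powers of an element of a finite group, as a finset. -/
def powersFinset {G : Type*} [Group G] [Fintype G] [DecidableEq G] (x : G) : Finset G :=
  (Finset.range (Fintype.card G)).image (x ^ ·)

theorem coe_powersFinset {G : Type*} [Group G] [Fintype G] [DecidableEq G] (x : G) :
    (powersFinset x : Set G) = Subgroup.zpowers x := by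
  ext y
  simp only [powersFinset, Finset.coe_image, Finset.coe_range, Set.mem_image, Set.mem_Iio,
    SetLike.mem_coe]
  constructor
  · rintro ⟨k, -, rfl⟩
    exact Subgroup.npow_mem_zpowers x k
  · intro hy
    rw [mem_zpowers_iff_mem_range_orderOf, Finset.mem_image] at hy
    obtain ⟨k, hk, rfl⟩ := hy
    exact ⟨k, (Finset.mem_range.mp hk).trans_le orderOf_le_card_univ, rfl⟩

/-- Cyclic subgroups of a finite group correspond to the finsets of powers of its elements. -/
noncomputable def cyclicSubgroupEquiv (G : Type*) [Group G] [Fintype G] [DecidableEq G] :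
    {H : Subgroup G // IsCyclic H} ≃ (Finset.univ.image (powersFinset (G := G))) :=
  Equiv.symm <| Equiv.ofBijective
    (fun s => ⟨Subgroup.closure s.1, by
      obtain ⟨x, -, hx⟩ := Finset.mem_image.mp s.2
      rw [← hx, coe_powersFinset, Subgroup.closure_eq]
      infer_instance⟩)
    (by
      constructor
      · rintro ⟨s, hs⟩ ⟨t, ht⟩ hst
        obtain ⟨x, -, rfl⟩ := Finset.mem_image.mp hs
        obtain ⟨y, -, rfl⟩ := Finset.mem_image.mp ht
        simp only [Subtype.mk.injEq, coe_powersFinset, Subgroup.closure_eq] at hst ⊢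
        rw [← Finset.coe_inj, coe_powersFinset, coe_powersFinset, hst]
      · rintro ⟨H, hH⟩
        obtain ⟨x, rfl⟩ := (Subgroup.isCyclic_iff_exists_zpowers_eq_top H).mp hH
        exact ⟨⟨powersFinset x, Finset.mem_image_of_mem _ (Finset.mem_univ x)⟩,
          Subtype.ext (by simp only [coe_powersFinset, Subgroup.closure_eq])⟩)

theorem coe_cyclicSubgroupEquiv {G : Type*} [Group G] [Fintype G] [DecidableEq G]
    (H : {H : Subgroup G // IsCyclic H}) : ((cyclicSubgroupEquiv G H).1 : Set G) = H.1 := by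
  obtain ⟨s, rfl⟩ := (cyclicSubgroupEquiv G).symm.surjective H
  rw [Equiv.apply_symm_apply]
  obtain ⟨x, -, hx⟩ := Finset.mem_image.mp s.2
  change _ = ((Subgroup.closure (s.1 : Set G) : Subgroup G) : Set G)
  rw [← hx, coe_powersFinset, Subgroup.closure_eq]

theorem card_cyclicSubgroup (G : Type*) [Group G] [Fintype G] [DecidableEq G] :
    Nat.card {H : Subgroup G // IsCyclic H} =
      (Finset.univ.image (powersFinset (G := G))).card := by
  rw [Nat.card_congr (cyclicSubgroupEquiv G), Nat.card_eq_fintype_card, Fintype.card_coe]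

/-- The finset of ordered pairs of permuting cyclic subgroups, each given by its elements. -/
def permutingPairs (G : Type*) [Group G] [Fintype G] [DecidableEq G] :
    Finset (Finset G × Finset G) :=
  let C := Finset.univ.image (powersFinset (G := G))
  (C ×ˢ C).filter fun p => p.1 * p.2 = p.2 * p.1

theorem card_permuting_cyclicSubgroup (G : Type*) [Group G] [Fintype G] [DecidableEq G] :
    Nat.card {p : Subgroup G × Subgroup G // IsCyclic p.1 ∧ IsCyclic p.2 ∧
      (p.1 : Set G) * (p.2 : Set G) = (p.2 : Set G) * (p.1 : Set G)} =
      (permutingPairs G).card := by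
  rw [← Fintype.card_coe, ← Nat.card_eq_fintype_card]
  refine Nat.card_congr (Equiv.ofBijective (fun p => ⟨((cyclicSubgroupEquiv G ⟨p.1.1, p.2.1⟩).1,
    (cyclicSubgroupEquiv G ⟨p.1.2, p.2.2.1⟩).1), ?_⟩) ⟨?_, ?_⟩)
  · refine Finset.mem_filter.mpr ⟨Finset.mk_mem_product (Subtype.prop _) (Subtype.prop _), ?_⟩
    simp only [← Finset.coe_inj, Finset.coe_mul, coe_cyclicSubgroupEquiv, p.2.2.2]
  · rintro ⟨⟨H, K⟩, hH, hK, h⟩ ⟨⟨H', K'⟩, hH', hK', h'⟩ heq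
    obtain ⟨hs, ht⟩ := Prod.mk.inj (congrArg Subtype.val heq)
    rw [← Finset.coe_inj, coe_cyclicSubgroupEquiv, coe_cyclicSubgroupEquiv,
      SetLike.coe_set_eq] at hs ht
    exact Subtype.ext (Prod.ext hs ht)
  · rintro ⟨⟨s, t⟩, hst⟩
    obtain ⟨hmem, hcomm⟩ := Finset.mem_filter.mp hst
    obtain ⟨hs, ht⟩ := Finset.mem_product.mp hmem
    obtain ⟨H, hH⟩ := (cyclicSubgroupEquiv G).surjective ⟨s, hs⟩
    obtain ⟨K, hK⟩ := (cyclicSubgroupEquiv G).surjective ⟨t, ht⟩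
    refine ⟨⟨(H.1, K.1), H.2, K.2, ?_⟩, ?_⟩
    · simp only [← coe_cyclicSubgroupEquiv, hH, hK, ← Finset.coe_mul]
      exact congrArg _ hcomm
    · simp only [Subtype.coe_eta, hH, hK]

theorem MulEquiv.isCyclic_mapSubgroup_iff {G G' : Type*} [Group G] [Group G'] (e : G ≃* G')
    (H : Subgroup G) : IsCyclic (e.mapSubgroup H) ↔ IsCyclic H :=
  (e.subgroupMap H).isCyclic.symm

theorem MulEquiv.coe_mapSubgroup_mul {G G' : Type*} [Group G] [Group G'] (e : G ≃* G')
    (H K : Subgroup G) :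
    (e.mapSubgroup H : Set G') * (e.mapSubgroup K : Set G') = e '' ((H : Set G) * (K : Set G)) :=
  (Set.image_mul e).symm

theorem card_cyclicSubgroup_congr {G G' : Type*} [Group G] [Group G'] (e : G ≃* G') :
    Nat.card {H : Subgroup G // IsCyclic H} = Nat.card {H : Subgroup G' // IsCyclic H} :=
  Nat.card_congr (e.mapSubgroup.toEquiv.subtypeEquiv fun H => (e.isCyclic_mapSubgroup_iff H).symm)

theorem card_permuting_cyclicSubgroup_congr {G G' : Type*} [Group G] [Group G'] (e : G ≃* G') :
    Nat.card {p : Subgroup G × Subgroup G // IsCyclic p.1 ∧ IsCyclic p.2 ∧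
      (p.1 : Set G) * (p.2 : Set G) = (p.2 : Set G) * (p.1 : Set G)} =
    Nat.card {p : Subgroup G' × Subgroup G' // IsCyclic p.1 ∧ IsCyclic p.2 ∧
      (p.1 : Set G') * (p.2 : Set G') = (p.2 : Set G') * (p.1 : Set G')} := by
  refine Nat.card_congr
    ((e.mapSubgroup.toEquiv.prodCongr e.mapSubgroup.toEquiv).subtypeEquiv fun p => ?_)
  refine and_congr (e.isCyclic_mapSubgroup_iff p.1).symm
    (and_congr (e.isCyclic_mapSubgroup_iff p.2).symm ?_)
  change _ ↔ (e.mapSubgroup p.1 : Set G') * (e.mapSubgroup p.2 : Set G') =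
    (e.mapSubgroup p.2 : Set G') * (e.mapSubgroup p.1 : Set G')
  rw [e.coe_mapSubgroup_mul, e.coe_mapSubgroup_mul, e.injective.image_injective.eq_iff]

theorem card_image_powersFinset_quaternionGroup_nine :
    (Finset.univ.image (powersFinset (G := QuaternionGroup 9))).card = 15 := by
  decide +kernel

theorem card_permutingPairs_quaternionGroup_nine :
    (permutingPairs (QuaternionGroup 9)).card = 153 := by
  decide +kernel

/-- The cyclic subgroup commutativity degree of `ZM(9,4,8)` equals `17/25`. -/
theorem csd_ZM948 :
    (Nat.card {p : Subgroup (ZM 9 4 8) × Subgroup (ZM 9 4 8) //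
        IsCyclic p.1 ∧ IsCyclic p.2 ∧
          (p.1 : Set (ZM 9 4 8)) * (p.2 : Set (ZM 9 4 8)) =
            (p.2 : Set (ZM 9 4 8)) * (p.1 : Set (ZM 9 4 8))} : ℚ) /
      (Nat.card {H : Subgroup (ZM 9 4 8) // IsCyclic H} : ℚ) ^ 2 = 17 / 25 := by
  rw [card_permuting_cyclicSubgroup_congr zmEquivQuaternionGroup,
    card_cyclicSubgroup_congr zmEquivQuaternionGroup, card_permuting_cyclicSubgroup,
    card_cyclicSubgroup, card_permutingPairs_quaternionGroup_nine,
    card_image_powersFinset_quaternionGroup_nine]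
  norm_num
end

section
/- If n is prime and ZM(m,n,r) is a ZM-group, then sd(ZM(m,n,r)) = (τ(m)² + 2τ(m)σ(m) + g(m)) / (τ(m) + σ(m))², where g(m) = m · Σ_{u,v | m} 1/gcd(u,v). -/
open Pointwise

/-- The arithmetic function `g(m) = m · Σ_{u,v ∣ m} 1/gcd(u,v)`. -/
noncomputable def gfun (m : ℕ) : ℚ :=
  (m : ℚ) * ∑ u ∈ m.divisors, ∑ v ∈ m.divisors, 1 / (Nat.gcd u v : ℚ)

theorem Subgroup.coe_sup_of_mul_comm {G : Type*} [Group G] {H K : Subgroup G}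
    (h : (H : Set G) * (K : Set G) = K * H) : ((H ⊔ K : Subgroup G) : Set G) = H * K := by
  apply subset_antisymm
  · let L : Subgroup G :=
      { carrier := H * K
        one_mem' := ⟨1, H.one_mem, 1, K.one_mem, one_mul 1⟩
        mul_mem' := fun {x y} hx hy => by
          have hxy := Set.mul_mem_mul hx hy
          rwa [mul_assoc, ← mul_assoc (K : Set G), ← h, mul_assoc (H : Set G), coe_mul_coe,
            ← mul_assoc, coe_mul_coe] at hxy
        inv_mem' := fun {x} hx => by
          have hx' := Set.inv_mem_inv.mpr hx
          rwa [mul_inv_rev, inv_coe_set, inv_coe_set, ← h] at hx' }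
    have hL : H ⊔ K ≤ L := sup_le
      (fun x hx => ⟨x, hx, 1, K.one_mem, mul_one x⟩) (fun x hx => ⟨1, H.one_mem, x, hx, one_mul x⟩)
    exact hL
  · rintro _ ⟨x, hx, y, hy, rfl⟩
    exact Subgroup.mul_mem_sup hx hy

/-- A group `G` generated by `a` and `b` as in a ZM-group, together with the affine action on
`ZMod m` in which `a` is the translation by `1` and `b` a homothety, and the degree map
recording exponents of `b`. -/
structure AffineModel (m n : ℕ) (G : Type*) [Group G] where
  /-- the generator acting as a translation -/
  a : G
  /-- the generator acting as a homothety -/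
  b : G
  /-- the affine action on `ZMod m` -/
  act : G →* (ZMod m ≃ᵃ[ZMod m] ZMod m)
  /-- the exponent of `b` -/
  deg : G →* Multiplicative (ZMod n)
  /-- the ratio of the homothety `b` -/
  ratio : ZMod m
  a_pow : a ^ m = 1
  act_a : ∀ x, act a x = x + 1
  act_b : ∀ x, act b x = ratio * x
  isUnit_ratio_sub_one : IsUnit (ratio - 1)
  deg_b : deg b = Multiplicative.ofAdd 1
  ker_deg : deg.ker = Subgroup.zpowers a

theorem ZMod.natCast_dvd_intCast_iff {m d : ℕ} (hd : d ∣ m) (z : ℤ) :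
    (d : ZMod m) ∣ (z : ZMod m) ↔ (d : ℤ) ∣ z := by
  constructor
  · rintro ⟨c, hc⟩
    obtain ⟨c, rfl⟩ := ZMod.intCast_surjective c
    have h : ((z - d * c : ℤ) : ZMod m) = 0 := by push_cast; rw [hc]; ring
    have h' := (Int.natCast_dvd_natCast.mpr hd).trans ((ZMod.intCast_zmod_eq_zero_iff_dvd _ m).mp h)
    simpa using dvd_add h' (dvd_mul_right (d : ℤ) c)
  · rintro ⟨c, rfl⟩
    exact ⟨c, by push_cast; rfl⟩

theorem AffineEquiv.dvd_apply_sub_apply {R : Type*} [CommRing R] (f : R ≃ᵃ[R] R) {d x y : R}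
    (h : d ∣ x - y) : d ∣ f x - f y := by
  obtain ⟨c, hc⟩ := h
  have := (f : R →ᵃ[R] R).linearMap_vsub x y
  simp only [vsub_eq_sub, hc, ← smul_eq_mul, map_smul] at this
  exact ⟨_, this.symm⟩

namespace AffineModel

variable {m n : ℕ} {G : Type*} [Group G] (M : AffineModel m n G)

theorem act_zpow (k : ℤ) (x : ZMod m) : M.act (M.a ^ k) x = x + k := by
  have hnat : ∀ (j : ℕ) (y : ZMod m), M.act (M.a ^ j) y = y + j := by
    intro j
    induction j with
    | zero => simp
    | succ j ih =>
      intro y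
      rw [pow_succ, map_mul, AffineEquiv.coe_mul, Function.comp_apply, ih, M.act_a]
      push_cast
      ring
  obtain ⟨j, rfl | rfl⟩ := k.eq_nat_or_neg
  · simpa using hnat j x
  · have h : M.act (M.a ^ j) (M.act (M.a ^ (-(j : ℤ))) x) = x := by
      rw [← Function.comp_apply (f := M.act (M.a ^ j)), ← AffineEquiv.coe_mul, ← map_mul]
      simp
    rw [hnat] at h
    push_cast
    linear_combination h

theorem act_mul (g h : G) (x : ZMod m) : M.act (g * h) x = M.act g (M.act h x) := by
  rw [map_mul, AffineEquiv.coe_mul, Function.comp_apply]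

theorem act_inv (g : G) (x : ZMod m) : M.act g (M.act g⁻¹ x) = x := by
  rw [← act_mul]; simp

/-- The stabilizer of the residue class of `x` modulo `d`. -/
def stab (d : ℕ) (x : ZMod m) : Subgroup G where
  carrier := {g | (d : ZMod m) ∣ M.act g x - x}
  one_mem' := by simp
  mul_mem' {g h} hg hh := by
    have := dvd_add ((M.act g).dvd_apply_sub_apply hh) hg
    simpa [act_mul] using this
  inv_mem' {g} hg := by
    have := (M.act g⁻¹).dvd_apply_sub_apply hg
    have h := M.act_inv g⁻¹ x
    rw [inv_inv] at h
    rw [h] at this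
    rwa [Set.mem_ofPred_eq, dvd_sub_comm]

theorem mem_stab {d : ℕ} {x : ZMod m} {g : G} :
    g ∈ M.stab d x ↔ (d : ZMod m) ∣ M.act g x - x := Iff.rfl

theorem dvd_act_sub_of_mem_stab {d : ℕ} {x y : ZMod m} {g : G} (hg : g ∈ M.stab d x)
    (h : (d : ZMod m) ∣ x - y) : (d : ZMod m) ∣ M.act g y - y := by
  have h1 := (M.act g).dvd_apply_sub_apply h
  have h2 := dvd_sub (dvd_add (M.mem_stab.mp hg) h) h1
  convert h2 using 1
  ring

theorem stab_congr {d : ℕ} {x y : ZMod m} (h : (d : ZMod m) ∣ x - y) :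
    M.stab d x = M.stab d y := by
  ext g
  exact ⟨fun hg => M.dvd_act_sub_of_mem_stab hg h,
    fun hg => M.dvd_act_sub_of_mem_stab hg ((dvd_sub_comm).mp h)⟩

theorem zpow_mem_stab {d : ℕ} (hd : d ∣ m) (x : ZMod m) (k : ℤ) :
    M.a ^ k ∈ M.stab d x ↔ (d : ℤ) ∣ k := by
  rw [mem_stab, act_zpow, add_sub_cancel_left, ZMod.natCast_dvd_intCast_iff hd]

theorem stab_le_stab {d e : ℕ} (h : e ∣ d) (x : ZMod m) : M.stab d x ≤ M.stab e x :=
  fun _ hg => (Nat.cast_dvd_cast h).trans hg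

theorem exists_zpow_mul_b_fixes (x : ZMod m) : ∃ i : ℤ, M.act (M.a ^ i * M.b) x = x := by
  obtain ⟨i, hi⟩ := ZMod.intCast_surjective (x - M.ratio * x)
  exact ⟨i, by rw [act_mul, act_b, act_zpow, hi]; ring⟩

theorem exists_fixed_point (i : ℤ) : ∃ x, M.act (M.a ^ i * M.b) x = x := by
  obtain ⟨u, hu⟩ := M.isUnit_ratio_sub_one
  refine ⟨-(↑u⁻¹ * i), ?_⟩
  rw [act_mul, act_b, act_zpow]
  have h := u.mul_inv
  rw [hu] at h
  linear_combination (-i : ZMod m) * h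

theorem dvd_sub_of_mem_stab {d : ℕ} {x y : ZMod m} {i : ℤ} (hx : M.a ^ i * M.b ∈ M.stab d x)
    (hy : M.a ^ i * M.b ∈ M.stab d y) : (d : ZMod m) ∣ x - y := by
  rw [mem_stab, act_mul, act_b, act_zpow] at hx hy
  rw [← M.isUnit_ratio_sub_one.dvd_mul_left]
  convert dvd_sub hx hy using 1
  ring

theorem deg_zpow_mul_b (i : ℤ) : M.deg (M.a ^ i * M.b) = Multiplicative.ofAdd 1 := by
  have h : M.a ^ i ∈ M.deg.ker := by rw [M.ker_deg]; exact ⟨i, rfl⟩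
  rw [map_mul, h, one_mul, M.deg_b]

theorem zpow_mul_b_notMem (hn : n.Prime) (i : ℤ) : M.a ^ i * M.b ∉ Subgroup.zpowers M.a := by
  have := Fact.mk hn
  rw [← M.ker_deg, MonoidHom.mem_ker, deg_zpow_mul_b]
  exact fun h => one_ne_zero (α := ZMod n) h

theorem stab_not_le (hn : n.Prime) (d : ℕ) (x : ZMod m) :
    ¬ M.stab d x ≤ Subgroup.zpowers M.a := by
  obtain ⟨i, hi⟩ := M.exists_zpow_mul_b_fixes x
  exact fun h => M.zpow_mul_b_notMem hn i (h (by rw [mem_stab, hi, sub_self]; exact dvd_zero _))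

theorem exists_zpow_mul_b_mem (hn : n.Prime) {H : Subgroup G}
    (hH : ¬ H ≤ Subgroup.zpowers M.a) : ∃ i : ℤ, M.a ^ i * M.b ∈ H := by
  have := Fact.mk hn
  obtain ⟨g, hg, hga⟩ := SetLike.not_le_iff_exists.mp hH
  rw [← M.ker_deg, MonoidHom.mem_ker] at hga
  have hj : (M.deg g).toAdd ≠ 0 := hga
  have h : g ^ ((M.deg g).toAdd⁻¹).val * M.b⁻¹ ∈ Subgroup.zpowers M.a := by
    rw [← M.ker_deg, MonoidHom.mem_ker, map_mul, map_inv, map_pow, M.deg_b, mul_inv_eq_one]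
    apply Multiplicative.toAdd.injective
    rw [toAdd_pow, toAdd_ofAdd, nsmul_eq_mul, ZMod.natCast_zmod_val, inv_mul_cancel₀ hj]
  obtain ⟨i, hi⟩ := h
  refine ⟨i, ?_⟩
  rw [show M.a ^ i = _ from hi, inv_mul_cancel_right]
  exact H.pow_mem hg _

theorem exists_forall_zpow_mem_iff (H : Subgroup G) :
    ∃ d, d ∣ m ∧ ∀ k : ℤ, M.a ^ k ∈ H ↔ (d : ℤ) ∣ k := by
  obtain ⟨c, hc⟩ := Int.subgroup_cyclic
    (Subgroup.toAddSubgroup' (H.comap (zpowersHom G M.a)))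
  have key : ∀ k : ℤ, M.a ^ k ∈ H ↔ (c.natAbs : ℤ) ∣ k := by
    intro k
    rw [Int.natAbs_dvd, ← Int.mem_zmultiples_iff, AddSubgroup.zmultiples_eq_closure, ← hc]
    rfl
  refine ⟨c.natAbs, ?_, key⟩
  have := (key m).mp (by rw [zpow_natCast, M.a_pow]; exact H.one_mem)
  exact_mod_cast this

/-- A subgroup of `⟨a⟩` is generated by `a ^ d` for a divisor `d` of `m`. -/
theorem exists_eq_zpowers {H : Subgroup G} (hH : H ≤ Subgroup.zpowers M.a) :
    ∃ d, d ∣ m ∧ H = Subgroup.zpowers (M.a ^ d) := by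
  obtain ⟨d, hd, h⟩ := M.exists_forall_zpow_mem_iff H
  refine ⟨d, hd, le_antisymm (fun g hg => ?_) ?_⟩
  · obtain ⟨k, rfl⟩ := hH hg
    obtain ⟨l, rfl⟩ := (h k).mp hg
    exact ⟨l, by simp [zpow_mul]⟩
  · rw [Subgroup.zpowers_le]
    simpa using h d

theorem zpow_mem_zpowers_iff {d : ℕ} (hd : d ∣ m) (k : ℤ) :
    M.a ^ k ∈ Subgroup.zpowers (M.a ^ d) ↔ (d : ℤ) ∣ k := by
  constructor
  · rintro ⟨l, hl⟩
    have h : M.a ^ d ∈ M.stab d 0 := by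
      simpa using (M.zpow_mem_stab hd 0 d).mpr dvd_rfl
    rw [← M.zpow_mem_stab hd 0, ← hl]
    exact Subgroup.zpow_mem _ h l
  · rintro ⟨l, rfl⟩
    exact ⟨l, by simp [zpow_mul]⟩

/-- A subgroup not contained in `⟨a⟩` is the stabilizer of a residue class. -/
theorem exists_eq_stab (hn : n.Prime) {H : Subgroup G}
    (hH : ¬ H ≤ Subgroup.zpowers M.a) : ∃ d, d ∣ m ∧ ∃ x, H = M.stab d x := by
  obtain ⟨d, hd, hdH⟩ := M.exists_forall_zpow_mem_iff H
  obtain ⟨i, hi⟩ := M.exists_zpow_mul_b_mem hn hH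
  obtain ⟨x, hx⟩ := M.exists_fixed_point i
  have hi' : M.a ^ i * M.b ∈ M.stab d x := by rw [mem_stab, hx, sub_self]; exact dvd_zero _
  refine ⟨d, hd, x, ?_⟩
  have := Fact.mk hn
  have key : ∀ g : G, ∃ (j : ℕ) (k : ℤ), g = M.a ^ k * (M.a ^ i * M.b) ^ j := by
    intro g
    have h : g * ((M.a ^ i * M.b) ^ ((M.deg g).toAdd).val)⁻¹ ∈ Subgroup.zpowers M.a := by
      rw [← M.ker_deg, MonoidHom.mem_ker, map_mul, map_inv, map_pow, deg_zpow_mul_b,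
        mul_inv_eq_one]
      apply Multiplicative.toAdd.injective
      rw [toAdd_pow, toAdd_ofAdd, nsmul_eq_mul, ZMod.natCast_zmod_val, mul_one]
    obtain ⟨k, hk⟩ := h
    exact ⟨_, k, by rw [show M.a ^ k = _ from hk, inv_mul_cancel_right]⟩
  ext g
  obtain ⟨j, k, rfl⟩ := key g
  rw [Subgroup.mul_mem_cancel_right _ (H.pow_mem hi j),
    Subgroup.mul_mem_cancel_right _ (Subgroup.pow_mem _ hi' j), hdH, M.zpow_mem_stab hd]

theorem stab_eq_stab_iff {d e : ℕ} (hd : d ∣ m) (he : e ∣ m) (x y : ZMod m) :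
    M.stab d x = M.stab e y ↔ d = e ∧ (d : ZMod m) ∣ x - y := by
  constructor
  · intro h
    have hde : d = e := by
      apply Nat.dvd_antisymm
      · rw [← Int.natCast_dvd_natCast, ← M.zpow_mem_stab hd x, h, M.zpow_mem_stab he]
      · rw [← Int.natCast_dvd_natCast, ← M.zpow_mem_stab he y, ← h, M.zpow_mem_stab hd]
    subst hde
    obtain ⟨i, hi⟩ := M.exists_zpow_mul_b_fixes x
    have hx : M.a ^ i * M.b ∈ M.stab d x := by rw [mem_stab, hi, sub_self]; exact dvd_zero _
    exact ⟨rfl, M.dvd_sub_of_mem_stab hx (h ▸ hx)⟩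
  · rintro ⟨rfl, h⟩
    exact M.stab_congr h

theorem normal_of_le {H : Subgroup G} (hH : H ≤ Subgroup.zpowers M.a) : H.Normal := by
  refine ⟨fun h hh g => ?_⟩
  obtain ⟨k, rfl⟩ := hH hh
  have hN : (Subgroup.zpowers M.a).Normal := M.ker_deg ▸ inferInstance
  obtain ⟨s, hs⟩ := hN.conj_mem M.a (Subgroup.mem_zpowers _) g
  simp only at hs hh ⊢
  rw [← conj_zpow, ← hs, ← zpow_mul, mul_comm, zpow_mul]
  exact H.zpow_mem hh s

theorem stab_mul_stab {d : ℕ} (hd : d ∣ m) (e : ℕ) (x : ZMod m) :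
    (M.stab d x : Set G) * (M.stab e x : Set G) = M.stab (d.gcd e) x := by
  apply subset_antisymm
  · rintro _ ⟨h, hh, k, hk, rfl⟩
    exact mul_mem (M.stab_le_stab (Nat.gcd_dvd_left d e) x hh)
      (M.stab_le_stab (Nat.gcd_dvd_right d e) x hk)
  · intro g hg
    obtain ⟨c, hc⟩ := M.mem_stab.mp hg
    obtain ⟨c, rfl⟩ := ZMod.intCast_surjective c
    have hb : ((d.gcd e : ℤ) : ZMod m) = _ := congrArg _ (Nat.gcd_eq_gcd_ab d e)
    push_cast at hb
    refine ⟨M.a ^ (d * (d.gcdA e * c)), (M.zpow_mem_stab hd x _).mpr (dvd_mul_right _ _),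
      M.a ^ (-(d * (d.gcdA e * c))) * g, ?_, by simp⟩
    refine ⟨d.gcdB e * c, ?_⟩
    rw [act_mul, act_zpow]
    push_cast
    linear_combination hc + (c : ZMod m) * hb

/-- Two stabilizers permute exactly when the residue classes they fix intersect. -/
theorem stab_mul_comm_iff (hn : n.Prime) {d e : ℕ} (hd : d ∣ m) (he : e ∣ m)
    (x y : ℤ) :
    (M.stab d x : Set G) * (M.stab e y : Set G) = (M.stab e y : Set G) * (M.stab d x : Set G) ↔
      ((d.gcd e : ℕ) : ℤ) ∣ x - y := by
  constructor
  · intro hcomm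
    have hL : ((M.stab d x ⊔ M.stab e y : Subgroup G) : Set G) = M.stab e y * M.stab d x :=
      (Subgroup.coe_sup_of_mul_comm hcomm).trans hcomm
    have hle : ¬ (M.stab d x ⊔ M.stab e y) ≤ Subgroup.zpowers M.a :=
      fun h => M.stab_not_le hn d x (le_sup_left.trans h)
    obtain ⟨f, hf, w, hw⟩ := M.exists_eq_stab hn hle
    have aux : ∀ (c : ℕ) (z : ZMod m), M.stab c z ≤ M.stab f w → (f : ZMod m) ∣ z - w := by
      intro c z hcz
      obtain ⟨i, hi⟩ := M.exists_zpow_mul_b_fixes z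
      refine M.dvd_sub_of_mem_stab (i := i) ?_ (hcz ?_) <;>
      · rw [mem_stab, hi, sub_self]; exact dvd_zero _
    have hx := aux d x (hw ▸ le_sup_left)
    have hy := aux e y (hw ▸ le_sup_right)
    have hyx : (f : ℤ) ∣ y - x := by
      rw [← ZMod.natCast_dvd_intCast_iff hf]
      push_cast
      simpa using dvd_sub hy hx
    have ht : M.a ^ (y - x) ∈ ((M.stab d x ⊔ M.stab e y : Subgroup G) : Set G) := by
      rw [hw]
      exact (M.zpow_mem_stab hf w _).mpr hyx
    rw [hL] at ht
    obtain ⟨k, hk, h, hh, hkh⟩ := ht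
    have hact : M.act h x = M.act k⁻¹ y := by
      have h1 : M.act (k * h) x = y := by
        rw [show k * h = _ from hkh, act_zpow]; push_cast; ring
      rw [← h1, ← act_mul]
      simp
    have hgm : d.gcd e ∣ m := (Nat.gcd_dvd_left d e).trans hd
    have h1 : ((d.gcd e : ℕ) : ZMod m) ∣ M.act h x - x := M.stab_le_stab (Nat.gcd_dvd_left d e) _ hh
    have h2 : ((d.gcd e : ℕ) : ZMod m) ∣ M.act k⁻¹ y - y :=
      M.stab_le_stab (Nat.gcd_dvd_right d e) _ (inv_mem hk)
    rw [← ZMod.natCast_dvd_intCast_iff hgm]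
    push_cast
    rw [hact] at h1
    simpa using dvd_sub h2 h1
  · rintro ⟨c, hc⟩
    obtain ⟨w, hxw, hyw⟩ : ∃ w : ℤ, (d : ℤ) ∣ x - w ∧ (e : ℤ) ∣ y - w := by
      have hb := Nat.gcd_eq_gcd_ab d e
      refine ⟨x - d * (d.gcdA e * c), by simp, -(d.gcdB e * c), ?_⟩
      linear_combination (-1 : ℤ) * hc - c * hb
    have hx := M.stab_congr (x := x) (y := w)
      (by exact_mod_cast (ZMod.natCast_dvd_intCast_iff hd _).mpr hxw)
    have hy := M.stab_congr (x := y) (y := w)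
      (by exact_mod_cast (ZMod.natCast_dvd_intCast_iff he _).mpr hyw)
    rw [hx, hy, M.stab_mul_stab hd, M.stab_mul_stab he, Nat.gcd_comm]

/-- The subgroups of `G`: those contained in `⟨a⟩`, indexed by the divisors of `m`, and the
stabilizers of the residue classes modulo the divisors of `m`. -/
def subgroupOfIndex : m.divisors ⊕ (Σ d : m.divisors, Fin d) → Subgroup G
  | .inl d => Subgroup.zpowers (M.a ^ (d : ℕ))
  | .inr ⟨d, x⟩ => M.stab d ((x : ℤ) : ZMod m)

theorem bijective_subgroupOfIndex (hm : 0 < m) (hn : n.Prime) :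
    Function.Bijective M.subgroupOfIndex := by
  have hle : ∀ d : ℕ, Subgroup.zpowers (M.a ^ d) ≤ Subgroup.zpowers M.a := fun d =>
    Subgroup.zpowers_le.mpr (Subgroup.npow_mem_zpowers _ d)
  constructor
  · rintro (⟨d, hd⟩ | ⟨⟨d, hd⟩, x⟩) (⟨e, he⟩ | ⟨⟨e, he⟩, y⟩) h <;>
      simp only [subgroupOfIndex] at h
    · have hd' := Nat.dvd_of_mem_divisors hd
      have he' := Nat.dvd_of_mem_divisors he
      have : d = e := by
        apply Nat.dvd_antisymm
        · rw [← Int.natCast_dvd_natCast, ← M.zpow_mem_zpowers_iff hd', h,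
            M.zpow_mem_zpowers_iff he']
        · rw [← Int.natCast_dvd_natCast, ← M.zpow_mem_zpowers_iff he', ← h,
            M.zpow_mem_zpowers_iff hd']
      subst this
      rfl
    · exact absurd (h ▸ hle d) (M.stab_not_le hn e _)
    · exact absurd (h ▸ hle e) (M.stab_not_le hn d _)
    · have hd' := Nat.dvd_of_mem_divisors hd
      obtain ⟨rfl, hxy⟩ := (M.stab_eq_stab_iff hd' (Nat.dvd_of_mem_divisors he) _ _).mp h
      rw [← Int.cast_sub, ZMod.natCast_dvd_intCast_iff hd'] at hxy
      have : x = y := by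
        apply Fin.ext
        have h1 : (x : ℕ) ≡ y [MOD d] := by
          rw [Nat.modEq_iff_dvd, dvd_sub_comm]
          exact hxy
        exact h1.eq_of_lt_of_lt x.2 y.2
      rw [this]
  · intro H
    by_cases hH : H ≤ Subgroup.zpowers M.a
    · obtain ⟨d, hd, rfl⟩ := M.exists_eq_zpowers hH
      exact ⟨.inl ⟨d, Nat.mem_divisors.mpr ⟨hd, hm.ne'⟩⟩, rfl⟩
    · obtain ⟨d, hd, x, rfl⟩ := M.exists_eq_stab hn hH
      obtain ⟨x, rfl⟩ := ZMod.intCast_surjective x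
      have hd0 : (0 : ℤ) < d := by exact_mod_cast Nat.pos_of_dvd_of_pos hd hm
      have hnn := Int.emod_nonneg x hd0.ne'
      have hlt := Int.emod_lt_of_pos x hd0
      refine ⟨.inr ⟨⟨d, Nat.mem_divisors.mpr ⟨hd, hm.ne'⟩⟩,
        ⟨(x % d).toNat, (Int.toNat_lt hnn).mpr hlt⟩⟩, ?_⟩
      apply M.stab_congr
      rw [← Int.cast_sub, ZMod.natCast_dvd_intCast_iff hd]
      simp only [Int.toNat_of_nonneg hnn]
      exact (Int.mod_modEq x d).symm.dvd

theorem card_subgroup (M : AffineModel m n G) (hm : 0 < m) (hn : n.Prime) :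
    Nat.card (Subgroup G) = m.divisors.card + ∑ d ∈ m.divisors, d := by
  rw [← Nat.card_congr (Equiv.ofBijective _ (M.bijective_subgroupOfIndex hm hn)),
    Nat.card_eq_fintype_card, Fintype.card_sum, Fintype.card_sigma, Fintype.card_coe]
  simp only [Fintype.card_fin]
  rw [Finset.sum_coe_sort m.divisors fun d => d]

end AffineModel

theorem Nat.card_gcd_dvd_sub {d : ℕ} (hd : 0 < d) (e : ℕ) :
    ∑ x : Fin d, ∑ y : Fin e, (if ((d.gcd e : ℕ) : ℤ) ∣ (x : ℤ) - (y : ℤ) then 1 else 0) =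
      d.lcm e := by
  have hg : 0 < d.gcd e := Nat.gcd_pos_of_pos_left e hd
  have inner : ∀ x : Fin d,
      ∑ y : Fin e, (if ((d.gcd e : ℕ) : ℤ) ∣ (x : ℤ) - (y : ℤ) then 1 else 0) = e / d.gcd e := by
    intro x
    rw [Fin.sum_univ_eq_sum_range
      (fun y => if ((d.gcd e : ℕ) : ℤ) ∣ (x : ℤ) - (y : ℤ) then 1 else 0) e,
      ← Finset.card_filter]
    have := Nat.count_modEq_card e hg (x : ℕ)
    rw [Nat.count_eq_card_filter_range, Nat.mod_eq_zero_of_dvd (Nat.gcd_dvd_right d e),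
      if_neg (Nat.not_lt_zero _), add_zero] at this
    rw [← this]
    simp only [Nat.modEq_iff_dvd]
  simp only [inner, Finset.sum_const, Finset.card_univ, Fintype.card_fin, smul_eq_mul]
  rw [← Nat.mul_div_assoc _ (Nat.gcd_dvd_right d e)]
  rfl

theorem gfun_eq_sum_lcm {m : ℕ} (hm : 0 < m) :
    gfun m = ∑ u ∈ m.divisors, ∑ v ∈ m.divisors, (u.lcm v : ℚ) := by
  rw [gfun, ← Nat.sum_div_divisors m, Finset.mul_sum]
  refine Finset.sum_congr rfl fun u hu => ?_
  rw [← Nat.sum_div_divisors m, Finset.mul_sum]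
  refine Finset.sum_congr rfl fun v hv => ?_
  obtain ⟨u', hu'⟩ := Nat.dvd_of_mem_divisors hu
  obtain ⟨v', hv'⟩ := Nat.dvd_of_mem_divisors hv
  have hu0 : 0 < u := Nat.pos_of_mem_divisors hu
  have hv0 : 0 < v := Nat.pos_of_mem_divisors hv
  have hu1 : m / u = u' := Nat.div_eq_of_eq_mul_right hu0 hu'
  have hv1 : m / v = v' := Nat.div_eq_of_eq_mul_right hv0 hv'
  have hu'0 : 0 < u' := Nat.pos_of_ne_zero fun h => by simp [h] at hu'; omega
  rw [hu1, hv1]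
  have hg : 0 < Nat.gcd u' v' := Nat.gcd_pos_of_pos_left _ hu'0
  have key : u.lcm v * Nat.gcd u' v' = m := by
    have h1 : u * v * Nat.gcd u' v' = m * Nat.gcd u v := by
      rw [← Nat.gcd_mul_left, ← Nat.gcd_mul_left, Nat.gcd_comm (m * u)]
      congr 1
      · rw [hu']; ring
      · rw [hv']; ring
    have h2 := Nat.gcd_mul_lcm u v
    have h3 : 0 < Nat.gcd u v := Nat.gcd_pos_of_pos_left _ hu0
    apply Nat.eq_of_mul_eq_mul_left h3
    rw [← mul_assoc, h2, h1, mul_comm]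
  have hgq : (Nat.gcd u' v' : ℚ) ≠ 0 := by exact_mod_cast hg.ne'
  rw [mul_one_div, div_eq_iff hgq]
  exact_mod_cast key.symm

namespace AffineModel

theorem card_mul_comm {m n : ℕ} {G : Type*} [Group G] (M : AffineModel m n G) (hm : 0 < m)
    (hn : n.Prime) :
    Nat.card {p : Subgroup G × Subgroup G // (p.1 : Set G) * (p.2 : Set G) = p.2 * p.1} =
      m.divisors.card ^ 2 + 2 * m.divisors.card * (∑ d ∈ m.divisors, d) +
        ∑ d ∈ m.divisors, ∑ e ∈ m.divisors, d.lcm e := by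
  classical
  let F := Equiv.ofBijective _ (M.bijective_subgroupOfIndex hm hn)
  rw [← Nat.card_congr ((F.prodCongr F).subtypeEquivOfSubtype
    (p := fun p => (p.1 : Set G) * (p.2 : Set G) = p.2 * p.1)),
    Nat.card_eq_fintype_card, Fintype.card_subtype, Finset.card_filter, Fintype.sum_prod_type]
  simp only [Fintype.sum_sum_type, Fintype.sum_sigma]
  have hnorm : ∀ d : m.divisors, (M.subgroupOfIndex (.inl d)).Normal := fun d =>
    M.normal_of_le (Subgroup.zpowers_le.mpr (Subgroup.npow_mem_zpowers _ d))
  have hl : ∀ (d : m.divisors) (i), (M.subgroupOfIndex (.inl d) : Set G) * M.subgroupOfIndex i =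
      M.subgroupOfIndex i * M.subgroupOfIndex (.inl d) := fun d i =>
    have := hnorm d
    (Subgroup.set_mul_normal_comm _ _).symm
  have hr : ∀ (d e : m.divisors) (x : Fin d) (y : Fin e),
      (M.subgroupOfIndex (.inr ⟨d, x⟩) : Set G) * M.subgroupOfIndex (.inr ⟨e, y⟩) =
        M.subgroupOfIndex (.inr ⟨e, y⟩) * M.subgroupOfIndex (.inr ⟨d, x⟩) ↔
      ((Nat.gcd d e : ℕ) : ℤ) ∣ (x : ℤ) - (y : ℤ) := fun d e x y =>
    M.stab_mul_comm_iff hn (Nat.dvd_of_mem_divisors d.2) (Nat.dvd_of_mem_divisors e.2) _ _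
  simp only [F, Equiv.prodCongr_apply, Prod.map, Equiv.ofBijective_apply, hr, eq_true (hl _ _),
    eq_true (hl _ _).symm, if_true, Finset.sum_add_distrib]
  have hcount : ∀ d : m.divisors, ∑ x : Fin d, ∑ e : m.divisors, ∑ y : Fin e,
      (if ((Nat.gcd d e : ℕ) : ℤ) ∣ (x : ℤ) - (y : ℤ) then 1 else 0) =
      ∑ e ∈ m.divisors, Nat.lcm d e := by
    intro d
    rw [Finset.sum_comm, ← Finset.sum_coe_sort m.divisors]
    exact Finset.sum_congr rfl fun e _ => Nat.card_gcd_dvd_sub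
      (Nat.pos_of_mem_divisors d.2) e
  simp only [hcount, Finset.sum_const, Finset.card_univ, Fintype.card_coe, Fintype.card_fin,
    smul_eq_mul, mul_one]
  rw [Finset.sum_coe_sort m.divisors fun d => d, ← Finset.sum_mul,
    Finset.sum_coe_sort m.divisors fun d => d,
    Finset.sum_coe_sort m.divisors fun d => ∑ e ∈ m.divisors, Nat.lcm d e]
  ring

end AffineModel

section Presentation

variable {m n r : ℕ}

theorem za_pow : za m n r ^ m = 1 :=
  PresentedGroup.one_of_mem (rels := ZMrel m n r) (x := FreeGroup.of 0 ^ m) (by simp [ZMrel])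

theorem zb_pow : zb m n r ^ n = 1 :=
  PresentedGroup.one_of_mem (rels := ZMrel m n r) (x := FreeGroup.of 1 ^ n) (by simp [ZMrel])

theorem zb_inv_mul_za_mul_zb : (zb m n r)⁻¹ * za m n r * zb m n r = za m n r ^ r :=
  mul_inv_eq_one.mp <| PresentedGroup.one_of_mem (rels := ZMrel m n r)
    (x := (FreeGroup.of 1)⁻¹ * FreeGroup.of 0 * FreeGroup.of 1 * (FreeGroup.of 0 ^ r)⁻¹)
    (by simp [ZMrel])

/-- The homomorphism out of `ZM(m,n,r)` given by images of the generators that satisfy the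
relations. -/
def zmLift {H : Type*} [Group H] (x y : H) (hx : x ^ m = 1) (hy : y ^ n = 1)
    (hxy : y⁻¹ * x * y = x ^ r) : ZM m n r →* H :=
  PresentedGroup.toGroup (f := ![x, y]) (by
    rintro _ (rfl | rfl | rfl) <;> simp [hx, hy, hxy])

section

variable {H : Type*} [Group H] {x y : H} (hx : x ^ m = 1) (hy : y ^ n = 1)
  (hxy : y⁻¹ * x * y = x ^ r)

@[simp]
theorem zmLift_za : zmLift x y hx hy hxy (za m n r) = x :=
  PresentedGroup.toGroup.of _

@[simp]
theorem zmLift_zb : zmLift x y hx hy hxy (zb m n r) = y :=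
  PresentedGroup.toGroup.of _

end

theorem closure_za_zb : Subgroup.closure {za m n r, zb m n r} = ⊤ := by
  rw [← PresentedGroup.closure_range_of (ZMrel m n r)]
  congr 1
  ext x
  simp [za, zb, Fin.exists_fin_two, eq_comm]

theorem zb_inv_pow_mul_za_mul_zb_pow (k : ℕ) :
    (zb m n r ^ k)⁻¹ * za m n r * zb m n r ^ k = za m n r ^ r ^ k := by
  induction k with
  | zero => simp
  | succ k ih =>
    calc _ = (zb m n r)⁻¹ * ((zb m n r ^ k)⁻¹ * za m n r * zb m n r ^ k) * zb m n r := by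
          rw [pow_succ]; group
      _ = ((zb m n r)⁻¹ * za m n r * zb m n r) ^ r ^ k := by
          rw [ih]
          simpa using (conj_pow (a := (zb m n r)⁻¹) (b := za m n r) (i := r ^ k)).symm
      _ = _ := by rw [zb_inv_mul_za_mul_zb, ← pow_mul, pow_succ, mul_comm]

theorem normal_zpowers_za (hn : 0 < n) : (Subgroup.zpowers (za m n r)).Normal := by
  rw [← Subgroup.normalizer_eq_top_iff, eq_top_iff, ← closure_za_zb, Subgroup.closure_le]
  have hb : zb m n r * za m n r * (zb m n r)⁻¹ = za m n r ^ r ^ (n - 1) := by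
    rw [← zb_inv_pow_mul_za_mul_zb_pow, ← inv_eq_of_mul_eq_one_left (a := zb m n r ^ (n - 1)),
      inv_inv]
    rw [← pow_succ, Nat.sub_add_cancel hn, zb_pow]
  rintro _ (rfl | rfl)
  · exact Subgroup.le_normalizer (Subgroup.mem_zpowers _)
  · refine Subgroup.mem_normalizer_iff.mpr fun h => ⟨?_, ?_⟩
    · rintro ⟨k, rfl⟩
      simp only
      rw [← conj_zpow, hb]
      exact Subgroup.zpow_mem _ (Subgroup.npow_mem_zpowers _ _) k
    · rintro ⟨k, hk⟩
      have h1 : h = ((zb m n r)⁻¹ * za m n r * zb m n r) ^ k := by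
        have := conj_zpow (a := (zb m n r)⁻¹) (b := za m n r) (i := k)
        rw [inv_inv] at this
        rw [this, show za m n r ^ k = _ from hk]
        group
      rw [h1, zb_inv_mul_za_mul_zb]
      exact Subgroup.zpow_mem _ (Subgroup.npow_mem_zpowers _ _) k

/-- The affine model of `ZM(m,n,r)`. -/
noncomputable def zmAffineModel (hr : 0 < r) (hn : n.Prime)
    (hmr : Nat.gcd m (r - 1) = 1) (hrn : r ^ n ≡ 1 [MOD m]) : AffineModel m n (ZM m n r) :=
  have hpow : (r : ZMod m) ^ n = 1 := by
    exact_mod_cast (ZMod.natCast_eq_natCast_iff _ _ m).mpr hrn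
  have hmul : (r : ZMod m) ^ (n - 1) * r = 1 := by
    rw [← pow_succ, Nat.sub_add_cancel hn.pos, hpow]
  let u : (ZMod m)ˣ := ⟨r ^ (n - 1), r, hmul, by rw [mul_comm, hmul]⟩
  let t : ZMod m ≃ᵃ[ZMod m] ZMod m :=
    AffineEquiv.constVAddHom (ZMod m) (ZMod m) (Multiplicative.ofAdd 1)
  let s : ZMod m ≃ᵃ[ZMod m] ZMod m := (LinearEquiv.smulOfUnit u).toAffineEquiv
  have ht : ∀ x, t x = x + 1 := fun x => add_comm 1 x
  have htk : ∀ (k : ℕ) (x : ZMod m), (t ^ k) x = x + k := fun k x => by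
    rw [← map_pow, ← ofAdd_nsmul, nsmul_one]
    exact add_comm _ x
  have hs : ∀ x, s x = u * x := fun x => rfl
  have hsk : ∀ (k : ℕ) (x : ZMod m), (s ^ k) x = u ^ k * x := fun k x => by
    induction k with
    | zero => simp
    | succ k ih =>
      rw [pow_succ', AffineEquiv.coe_mul, Function.comp_apply, ih, hs, pow_succ']
      ring
  { a := za m n r
    b := zb m n r
    act := zmLift t s
      (AffineEquiv.ext fun x => by simp [htk])
      (AffineEquiv.ext fun x => by
        rw [hsk, show (u : ZMod m) = r ^ (n - 1) from rfl, ← pow_mul,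
          mul_comm (n - 1), pow_mul, hpow]
        simp)
      (by
        rw [mul_assoc, inv_mul_eq_iff_eq_mul]
        refine AffineEquiv.ext fun x => ?_
        rw [AffineEquiv.coe_mul, AffineEquiv.coe_mul, Function.comp_apply, Function.comp_apply,
          htk, hs, hs, ht]
        linear_combination -hmul)
    deg := zmLift 1 (Multiplicative.ofAdd 1) (one_pow _)
      (by rw [← ofAdd_nsmul]; simp) (by simp)
    ratio := u
    a_pow := za_pow
    act_a := fun x => by rw [zmLift_za, ht]
    act_b := fun x => by rw [zmLift_zb, hs]
    isUnit_ratio_sub_one := by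
      have h1 : IsUnit ((r - 1 : ℕ) : ZMod m) :=
        (ZMod.isUnit_iff_coprime _ _).mpr (Nat.Coprime.symm hmr)
      rw [Nat.cast_sub hr, Nat.cast_one] at h1
      have h2 : (u : ZMod m) - 1 = -(u * (r - 1)) := by
        have : (u : ZMod m) * r = 1 := hmul
        linear_combination this
      rw [h2]
      exact (u.isUnit.mul h1).neg
    deg_b := zmLift_zb _ _ _
    ker_deg := by
      apply le_antisymm
      · intro g hg
        have hN : (Subgroup.zpowers (za m n r)).Normal := normal_zpowers_za hn.pos
        have htop : Subgroup.zpowers (za m n r) ⊔ Subgroup.zpowers (zb m n r) = ⊤ := by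
          rw [eq_top_iff, ← closure_za_zb, Subgroup.closure_le]
          rintro _ (rfl | rfl)
          · exact Subgroup.mem_sup_left (Subgroup.mem_zpowers _)
          · exact Subgroup.mem_sup_right (Subgroup.mem_zpowers _)
        have hg' : g ∈ Subgroup.zpowers (za m n r) ⊔ Subgroup.zpowers (zb m n r) :=
          htop ▸ Subgroup.mem_top g
        obtain ⟨_, ⟨i, rfl⟩, _, ⟨j, rfl⟩, rfl⟩ := Subgroup.mem_sup_of_normal_left.mp hg'
        simp only [MonoidHom.mem_ker, map_mul, map_zpow, zmLift_za, zmLift_zb, one_zpow,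
          one_mul] at hg
        have hj : (j : ZMod n) = 0 := by
          have := congrArg Multiplicative.toAdd hg
          simpa using this
        obtain ⟨l, rfl⟩ := (ZMod.intCast_zmod_eq_zero_iff_dvd j n).mp hj
        simp only [zpow_mul, zpow_natCast, zb_pow, one_zpow, mul_one]
        exact ⟨i, rfl⟩
      · rw [Subgroup.zpowers_le, MonoidHom.mem_ker, zmLift_za] }

end Presentation

/-- For `n` prime, the subgroup commutativity degree of `ZM(m,n,r)` is
`(τ(m)² + 2τ(m)σ(m) + g(m)) / (τ(m) + σ(m))²`. -/
theorem sd_ZM_of_prime (m n r : ℕ)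
    (hm : 0 < m) (hr : 0 < r) (hnp : n.Prime)
    (h1 : Nat.gcd m n = 1) (h2 : Nat.gcd m (r - 1) = 1) (h3 : r ^ n ≡ 1 [MOD m]) :
    (Nat.card {p : Subgroup (ZM m n r) × Subgroup (ZM m n r) //
        (p.1 : Set (ZM m n r)) * (p.2 : Set (ZM m n r)) =
          (p.2 : Set (ZM m n r)) * (p.1 : Set (ZM m n r))} : ℚ) /
      (Nat.card (Subgroup (ZM m n r)) : ℚ) ^ 2 =
    ((m.divisors.card : ℚ) ^ 2 +
        2 * (m.divisors.card : ℚ) * (∑ d ∈ m.divisors, (d : ℚ)) + gfun m) /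
      ((m.divisors.card : ℚ) + ∑ d ∈ m.divisors, (d : ℚ)) ^ 2 := by
  have M := zmAffineModel hr hnp h2 h3
  rw [M.card_mul_comm hm hnp, M.card_subgroup hm hnp, gfun_eq_sum_lcm hm]
  push_cast
  rfl
end
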